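/- (Proposition 3(i)) Under the stated setup, the adjustment multiplier weight function minimising the limiting Kullback–Leibler divergence Ψ ↦ d_KL(μ*‖π^Ψ) over all measurable positive adjustment functions Ψ with 0 < ν(Ψ) < ∞ is Ψ*_{KL,R}(ξ) = L(ξ,Ξ̃); that is, for every admissible Ψ, d_KL(μ*‖π^{Ψ*_{KL,R}}) ≤ d_KL(μ*‖π^Ψ). In particular the minimiser does not depend on the proposal kernel R. -/

import Mathlib

open MeasureTheory ProbabilityTheory
open scoped ENNReal Classical

/-- Kullback–Leibler divergence `d_KL(μ‖λ) = ∫ log (dμ/dλ) dμ`, with value `⊤` when `μ`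
is not absolutely continuous with respect to `λ` or the log-likelihood ratio is not
integrable. -/
noncomputable def klDivE {α : Type*} [MeasurableSpace α] (μ lam : Measure α) : EReal :=
  if μ ≪ lam ∧ Integrable (fun x => Real.log ((μ.rnDeriv lam x).toReal)) μ
  then ((∫ x, Real.log ((μ.rnDeriv lam x).toReal) ∂μ : ℝ) : EReal) else ⊤

/-- The limiting instrumental distribution `π^Ψ = (ν[Ψ] ⊗ R)/ν(Ψ)` on `Ξ × Ξ̃` associated
with an adjustment multiplier weight function `Ψ`. -/
noncomputable def piAux {Ξ Ξt : Type*} [MeasurableSpace Ξ] [MeasurableSpace Ξt]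
    (ν : Measure Ξ) (R : Kernel Ξ Ξt) (Ψ : Ξ → ℝ) : Measure (Ξ × Ξt) :=
  ((((ν.withDensity fun x => ENNReal.ofReal (Ψ x)) ⊗ₘ R) Set.univ)⁻¹) •
    ((ν.withDensity fun x => ENNReal.ofReal (Ψ x)) ⊗ₘ R)

open InformationTheory

/-- For measures of equal finite mass, `klDivE` agrees with Mathlib's `klDiv`. -/
theorem klDivE_eq_klDiv {α : Type*} [MeasurableSpace α] (μ lam : Measure α)
    [IsFiniteMeasure μ] [IsFiniteMeasure lam] (h : μ Set.univ = lam Set.univ) : klDivE μ lam = (klDiv μ lam : EReal) := by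
  by_cases hc : μ ≪ lam ∧ Integrable (llr μ lam) μ
  · unfold llr at hc
    rw [klDivE, if_pos hc, ← ENNReal.ofReal_toReal (klDiv_ne_top hc.1 hc.2),
      toReal_klDiv_of_measure_eq hc.1 h, EReal.coe_ennreal_ofReal, max_eq_left]
    · rfl
    · rw [← toReal_klDiv_of_measure_eq hc.1 h]
      exact ENNReal.toReal_nonneg
  · have h_top : klDiv μ lam = ⊤ := klDiv_eq_top_iff.2 fun h1 h2 => hc ⟨h1, h2⟩
    unfold llr at hc
    rw [klDivE, if_neg hc, h_top, EReal.coe_ennreal_top]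

/-- The normalization of a kernel by its total mass. -/
noncomputable def normalizedKernel {Ξ Ξt : Type*} [MeasurableSpace Ξ] [MeasurableSpace Ξt]
    (L : Kernel Ξ Ξt) : Kernel Ξ Ξt where
  toFun x := ((L x) Set.univ)⁻¹ • L x
  measurable' := by
    refine Measure.measurable_of_measurable_coe _ fun s hs => ?_
    simp only [Measure.smul_apply, smul_eq_mul]
    exact (L.measurable_coe MeasurableSet.univ).inv.mul (L.measurable_coe hs)

theorem isMarkovKernel_normalizedKernel {Ξ Ξt : Type*} [MeasurableSpace Ξ] [MeasurableSpace Ξt]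
    (L : Kernel Ξ Ξt) [IsFiniteKernel L] (hL_pos : ∀ x, 0 < (L x) Set.univ) :
    IsMarkovKernel (normalizedKernel L) :=
  ⟨fun x => ⟨ENNReal.inv_mul_cancel (hL_pos x).ne' (measure_ne_top _ _)⟩⟩

/-- A finite kernel is its total mass times its normalization. -/
theorem withDensity_compProd_normalizedKernel {Ξ Ξt : Type*} [MeasurableSpace Ξ]
    [MeasurableSpace Ξt] (ν : Measure Ξ) [SFinite ν] (L : Kernel Ξ Ξt) [IsFiniteKernel L]
    (hL_pos : ∀ x, 0 < (L x) Set.univ) :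
    (ν.withDensity fun x => (L x) Set.univ) ⊗ₘ normalizedKernel L = ν ⊗ₘ L := by
  have := isMarkovKernel_normalizedKernel L hL_pos
  have hm : Measurable fun x => (L x) Set.univ := L.measurable_coe MeasurableSet.univ
  ext s hs
  rw [Measure.compProd_apply hs, Measure.compProd_apply hs,
    lintegral_withDensity_eq_lintegral_mul _ hm (Kernel.measurable_kernel_prodMk_left hs)]
  refine lintegral_congr fun x => ?_
  change (L x) Set.univ * (((L x) Set.univ)⁻¹ * L x (Prod.mk x ⁻¹' s)) = _
  rw [← mul_assoc, ENNReal.mul_inv_cancel (hL_pos x).ne' (measure_ne_top _ _), one_mul]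

/-- `π^Ψ` disintegrates as the normalized first marginal followed by `R`. -/
theorem piAux_eq_compProd {Ξ Ξt : Type*} [MeasurableSpace Ξ] [MeasurableSpace Ξt]
    (ν : Measure Ξ) [SFinite ν] (R : Kernel Ξ Ξt) [IsMarkovKernel R] (Ψ : Ξ → ℝ) :
    piAux ν R Ψ =
      (((ν.withDensity fun x => ENNReal.ofReal (Ψ x)) Set.univ)⁻¹ •
        ν.withDensity fun x => ENNReal.ofReal (Ψ x)) ⊗ₘ R := by
  rw [piAux, Measure.compProd_apply_univ, Measure.compProd_smul_left]

theorem isProbabilityMeasure_inv_smul {α : Type*} [MeasurableSpace α] (μ : Measure α)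
    (h0 : μ Set.univ ≠ 0) (htop : μ Set.univ ≠ ⊤) :
    IsProbabilityMeasure ((μ Set.univ)⁻¹ • μ) :=
  ⟨ENNReal.inv_mul_cancel h0 htop⟩

/-- Proposition 3(i). The adjustment multiplier weight function minimising
`Ψ ↦ d_KL(μ*‖π^Ψ)` over all measurable positive `Ψ` with `0 < ν(Ψ) < ∞` is
`Ψ*_{KL,R}(ξ) = L(ξ,Ξ̃)`; in particular it does not depend on the proposal kernel `R`. -/
theorem klDiv_optimal_adjustment_weight
    {Ξ Ξt : Type*} [MeasurableSpace Ξ] [MeasurableSpace Ξt]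
    (ν : Measure Ξ) [IsProbabilityMeasure ν]
    (L : Kernel Ξ Ξt) [IsFiniteKernel L]
    (R : Kernel Ξ Ξt) [IsMarkovKernel R]
    (hLR : ∀ x, L x ≪ R x)
    (hL_pos : ∀ x, 0 < (L x) Set.univ)
    (hνL_pos : 0 < (ν ⊗ₘ L) Set.univ)
    -- the limiting target distribution `μ* = (ν ⊗ L)/νL(Ξ̃)`
    (μstar : Measure (Ξ × Ξt))
    (hμstar : μstar = (((ν ⊗ₘ L) Set.univ)⁻¹) • (ν ⊗ₘ L))
    -- the optimal adjustment weight `Ψ*_{KL,R}(ξ) = L(ξ,Ξ̃)`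
    (ΨKL : Ξ → ℝ) (hΨKL : ∀ x, ΨKL x = ((L x) Set.univ).toReal) :
    ∀ Ψ : Ξ → ℝ, Measurable Ψ → (∀ x, 0 < Ψ x) → Integrable Ψ ν → 0 < ∫ x, Ψ x ∂ν →
      klDivE μstar (piAux ν R ΨKL) ≤ klDivE μstar (piAux ν R Ψ) := by
  intro Ψ hΨm hΨpos hΨint hΨ
  have hK := isMarkovKernel_normalizedKernel L hL_pos
  have hcomp := withDensity_compProd_normalizedKernel ν L hL_pos
  have hmass : (ν ⊗ₘ L) Set.univ = (ν.withDensity fun x => (L x) Set.univ) Set.univ := by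
    rw [← hcomp, Measure.compProd_apply_univ]
  have hKL : (fun x => ENNReal.ofReal (ΨKL x)) = fun x => (L x) Set.univ := by
    funext x
    rw [hΨKL, ENNReal.ofReal_toReal (measure_ne_top _ _)]
  have hΨuniv : (ν.withDensity fun x => ENNReal.ofReal (Ψ x)) Set.univ
      = ENNReal.ofReal (∫ x, Ψ x ∂ν) := by
    rw [withDensity_apply _ MeasurableSet.univ, Measure.restrict_univ,
      ofReal_integral_eq_lintegral_ofReal hΨint (ae_of_all _ fun x => (hΨpos x).le)]
  rw [piAux_eq_compProd, piAux_eq_compProd, hKL]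
  have hμ : μstar = (((ν.withDensity fun x => (L x) Set.univ) Set.univ)⁻¹ •
      ν.withDensity fun x => (L x) Set.univ) ⊗ₘ normalizedKernel L := by
    rw [hμstar, hmass, Measure.compProd_smul_left, hcomp]
  have hρ := isProbabilityMeasure_inv_smul (ν.withDensity fun x => (L x) Set.univ)
    (hmass ▸ hνL_pos.ne') (hmass ▸ measure_ne_top _ _)
  have hρΨ := isProbabilityMeasure_inv_smul (ν.withDensity fun x => ENNReal.ofReal (Ψ x))
    (by rw [hΨuniv]; exact (ENNReal.ofReal_pos.2 hΨ).ne')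
    (by rw [hΨuniv]; exact ENNReal.ofReal_ne_top)
  rw [hμ, klDivE_eq_klDiv _ _ (by simp only [measure_univ]),
    klDivE_eq_klDiv _ _ (by simp only [measure_univ]), EReal.coe_ennreal_le_coe_ennreal_iff,
    klDiv_compProd_eq_add (ν := _ • ν.withDensity fun x => ENNReal.ofReal (Ψ x))]
  exact le_add_self
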